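/- arXiv:2511.11156 — 6 statements merged into one kernel-verified Lean document; each statement's English description precedes it below -/
import Mathlib

section
/- Let X be a locally connected topological space, let a group G act on X by homeomorphisms (a continuous group action), and let H be a subgroup of G of finite index. Then the orbit space X/H (with the quotient topology, for the restricted H-action) has infinitely many connected components if and only if the orbit space X/G has infinitely many connected components. -/
namespace MulAction

variable {G X : Type*} [Group G] [MulAction G X]

/-- The canonical projection `X/H → X/G` for a subgroup `H` of `G`. -/
def orbitQuotientMap (X : Type*) [MulAction G X] (H : Subgroup G) :
    Quotient (orbitRel H X) → Quotient (orbitRel G X) :=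
  Quotient.map id fun _ _ h ↦ orbitRel_subgroup_le H h

theorem orbitQuotientMap_surjective (H : Subgroup G) :
    Function.Surjective (orbitQuotientMap X H) := by
  rintro ⟨x⟩
  exact ⟨Quotient.mk _ x, rfl⟩

/-- The fibre of `X/H → X/G` over the orbit of `x` is parametrised by the cosets of `H`. -/
theorem orbitQuotientMap_preimage_singleton (H : Subgroup G) (x : X) :
    orbitQuotientMap X H ⁻¹' {Quotient.mk _ x} =
      Set.range fun q : G ⧸ H ↦ Quotient.mk (orbitRel H X) (q.out⁻¹ • x) := by
  ext y
  induction y using Quotient.inductionOn with | h y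
  constructor
  · intro h
    obtain ⟨g, rfl⟩ : y ∈ orbit G x := orbitRel_apply.mp (Quotient.exact h)
    obtain ⟨h, hh⟩ := QuotientGroup.mk_out_eq_mul H g⁻¹
    refine ⟨(g⁻¹ : G), Quotient.sound (orbitRel_apply.mpr ⟨h⁻¹, ?_⟩)⟩
    simp [hh, Subgroup.smul_def, mul_smul]
  · rintro ⟨q, hq⟩
    rw [← hq]
    exact Quotient.sound (orbitRel_apply.mpr ⟨_, rfl⟩)

theorem finite_orbitQuotientMap_preimage_singleton (H : Subgroup G) [H.FiniteIndex]
    (y : Quotient (orbitRel G X)) : (orbitQuotientMap X H ⁻¹' {y}).Finite := by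
  induction y using Quotient.inductionOn with | h x
  rw [orbitQuotientMap_preimage_singleton]
  exact Set.finite_range _

variable [TopologicalSpace X]

theorem continuous_orbitQuotientMap (H : Subgroup G) : Continuous (orbitQuotientMap X H) :=
  continuous_quot_lift _ continuous_quot_mk

variable [ContinuousConstSMul G X]

theorem isOpenMap_orbitQuotientMap (H : Subgroup G) : IsOpenMap (orbitQuotientMap X H) :=
  .of_comp continuous_quot_mk Quot.mk_surjective
    (isOpenQuotientMap_quotientMk (Γ := G) (T := X)).isOpenMap

theorem isClosedMap_orbitQuotientMap (H : Subgroup G) [H.FiniteIndex] :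
    IsClosedMap (orbitQuotientMap X H) := by
  intro C hC
  rw [← (isOpenQuotientMap_quotientMk (Γ := G) (T := X)).isQuotientMap.isClosed_preimage]
  have key : Quotient.mk (orbitRel G X) ⁻¹' (orbitQuotientMap X H '' C) =
      ⋃ q : G ⧸ H, (fun x ↦ Quotient.mk (orbitRel H X) (q.out⁻¹ • x)) ⁻¹' C := by
    ext x
    have hx := Set.ext_iff.mp (orbitQuotientMap_preimage_singleton H x)
    simp only [Set.mem_preimage, Set.mem_singleton_iff, Set.mem_range] at hx
    simp only [Set.mem_preimage, Set.mem_image, Set.mem_iUnion, hx]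
    grind
  rw [key]
  exact isClosed_iUnion_of_finite fun q ↦
    hC.preimage (continuous_quot_mk.comp (continuous_const_smul _))

end MulAction

/-- Let `X` be a locally connected topological space with a group `G`
acting on it by homeomorphisms (a continuous group action), and let `H ≤ G` have finite
index.  Then the orbit space `X/H` (with the quotient topology) has infinitely many
connected components iff `X/G` has infinitely many connected components. -/
theorem stmt_2 {X : Type*} [TopologicalSpace X] [LocallyConnectedSpace X]
    {G : Type*} [Group G] [MulAction G X] [ContinuousConstSMul G X]
    (H : Subgroup G) [H.FiniteIndex] :
    Infinite (ConnectedComponents (Quotient (MulAction.orbitRel H X))) ↔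
      Infinite (ConnectedComponents (Quotient (MulAction.orbitRel G X))) := by
  have hcont := MulAction.continuous_orbitQuotientMap (X := X) H
  rw [← not_iff_not, not_infinite_iff_finite, not_infinite_iff_finite]
  constructor <;> intro hfin
  · refine Finite.of_surjective hcont.connectedComponentsMap fun c ↦ ?_
    obtain ⟨y, rfl⟩ := ConnectedComponents.surjective_coe c
    obtain ⟨x, rfl⟩ := MulAction.orbitQuotientMap_surjective H y
    exact ⟨x, rfl⟩
  · exact IsOpenMap.finite_connectedComponents_of_finite_preimage_singleton
      (MulAction.isOpenMap_orbitQuotientMap H) (MulAction.isClosedMap_orbitQuotientMap H) hcont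
      (MulAction.finite_orbitQuotientMap_preimage_singleton H)
end

section
/- Fix a₃ ∈ ℝ, λ with 0 < λ < 1/2, and C with 0 < C < 1. Let h₀ : [a₃, ∞) → ℝ be the solution of h₀'(t) = exp(−h₀(t)²/2), h₀(a₃) = √(−2·log λ), and let f_C : [a₃, ∞) → ℝ be the solution of f_C''(t) = C·exp(−h₀(t)²)·f_C(t), f_C(a₃) = 1, f_C'(a₃) = 0. Then 0 ≤ f_C'(t) ≤ f_C(t)·h₀(t)·h₀'(t) for every t ≥ a₃; in other words f_C'(t)/(f_C(t)·h₀(t)·h₀'(t)) ∈ [0, 1]. -/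
theorem le_of_hasDerivWithinAt_Ici_nonneg {a : ℝ} {g g' : ℝ → ℝ}
    (hg : ∀ t ∈ Set.Ici a, HasDerivWithinAt g (g' t) (Set.Ici a) t)
    (hg' : ∀ t ∈ Set.Ici a, 0 ≤ g' t) {t : ℝ} (ht : t ∈ Set.Ici a) : g a ≤ g t :=
  monotoneOn_of_hasDerivWithinAt_nonneg (convex_Ici a)
    (fun x hx => (hg x hx).continuousWithinAt)
    (fun x hx => (hg x (interior_subset hx)).mono interior_subset)
    (fun x hx => hg' x (interior_subset hx)) Set.self_mem_Ici ht ht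


/-- Fix `a₃ ∈ ℝ`, `0 < λ < 1/2`, `0 < C < 1`.  Let `h₀` solve
`h₀' t = exp (-(h₀ t)²/2)`, `h₀ a₃ = √(-2 log λ)` on `[a₃, ∞)`, and let `f` (with
derivative `f'`) solve `f'' t = C · exp (-(h₀ t)²) · f t`, `f a₃ = 1`, `f' a₃ = 0`.
Then `0 ≤ f' t ≤ f t · h₀ t · h₀' t` for every `t ≥ a₃`, i.e.
`f' t / (f t · h₀ t · h₀' t) ∈ [0, 1]` (here `h₀' t = exp (-(h₀ t)²/2)`). -/
theorem stmt_8 (a₃ lam C : ℝ) (hlam₀ : 0 < lam) (hlam₁ : lam < 1 / 2)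
    (hC₀ : 0 < C) (hC₁ : C < 1)
    (h₀ : ℝ → ℝ) (h₀init : h₀ a₃ = Real.sqrt (-2 * Real.log lam))
    (h₀ODE : ∀ t ∈ Set.Ici a₃,
      HasDerivWithinAt h₀ (Real.exp (-(h₀ t) ^ 2 / 2)) (Set.Ici a₃) t)
    (f f' : ℝ → ℝ) (finit : f a₃ = 1) (f'init : f' a₃ = 0)
    (fODE : ∀ t ∈ Set.Ici a₃, HasDerivWithinAt f (f' t) (Set.Ici a₃) t)
    (f'ODE : ∀ t ∈ Set.Ici a₃,
      HasDerivWithinAt f' (C * Real.exp (-(h₀ t) ^ 2) * f t) (Set.Ici a₃) t) :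
    ∀ t ∈ Set.Ici a₃,
      0 ≤ f' t ∧ f' t ≤ f t * h₀ t * Real.exp (-(h₀ t) ^ 2 / 2) := by
  have mul_nonneg_of_ode : ∀ t ∈ Set.Ici a₃, 0 ≤ f t * f' t := by
    intro t ht
    have key := le_of_hasDerivWithinAt_Ici_nonneg
      (fun s hs => (fODE s hs).mul (f'ODE s hs))
      (fun s _ => by
        have : 0 ≤ C * Real.exp (-(h₀ s) ^ 2) * f s ^ 2 := by positivity
        nlinarith [sq_nonneg (f' s)]) ht
    simpa [f'init] using key
  have one_le_sq : ∀ t ∈ Set.Ici a₃, 1 ≤ f t * f t := by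
    intro t ht
    have key := le_of_hasDerivWithinAt_Ici_nonneg
      (fun s hs => (fODE s hs).mul (fODE s hs))
      (fun s hs => by nlinarith [mul_nonneg_of_ode s hs]) ht
    simpa [finit] using key
  have f_pos : ∀ t ∈ Set.Ici a₃, 0 < f t := by
    intro t ht
    by_contra! hneg
    have hcont : ContinuousOn f (Set.Icc a₃ t) := fun x hx =>
      ((fODE x hx.1).continuousWithinAt).mono Set.Icc_subset_Ici_self
    obtain ⟨x, hx, hx0⟩ := intermediate_value_Icc' ht hcont
      (show (0 : ℝ) ∈ Set.Icc (f t) (f a₃) from ⟨hneg, by simp [finit]⟩)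
    have := one_le_sq x hx.1
    norm_num [hx0] at this
  intro t ht
  refine ⟨nonneg_of_mul_nonneg_right (mul_nonneg_of_ode t ht) (f_pos t ht), ?_⟩
  -- The Wronskian of `f` and `exp (h₀² / 2)`, which solves `g'' = exp (-h₀²) g`, is nondecreasing.
  have hexp : ∀ s, Real.exp (-(h₀ s) ^ 2 / 2) * Real.exp ((h₀ s) ^ 2 / 2) = 1 := by
    intro s
    rw [← Real.exp_add, ← Real.exp_zero]
    ring_nf
  have hexp_sq : ∀ s, Real.exp (-(h₀ s) ^ 2) = Real.exp (-(h₀ s) ^ 2 / 2) ^ 2 := by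
    intro s
    rw [sq (Real.exp _), ← Real.exp_add]
    ring_nf
  have wronskian := le_of_hasDerivWithinAt_Ici_nonneg
    (g := fun s => f s * h₀ s - f' s * Real.exp ((h₀ s) ^ 2 / 2))
    (g' := fun s => (1 - C) * (Real.exp (-(h₀ s) ^ 2 / 2) * f s))
    (fun s hs => by
      refine (((fODE s hs).mul (h₀ODE s hs)).sub
        ((f'ODE s hs).mul (((h₀ODE s hs).pow 2).div_const 2).exp)).congr_deriv ?_
      rw [hexp_sq]
      push_cast
      linear_combination
        -(f' s * h₀ s + C * f s * Real.exp (-(h₀ s) ^ 2 / 2)) * hexp s)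
    (fun s hs => mul_nonneg (by linarith) (mul_pos (Real.exp_pos _) (f_pos s hs)).le) ht
  simp only [finit, f'init, h₀init] at wronskian
  have hW : 0 ≤ f t * h₀ t - f' t * Real.exp ((h₀ t) ^ 2 / 2) := by
    linarith [Real.sqrt_nonneg (-2 * Real.log lam)]
  linear_combination Real.exp (-(h₀ t) ^ 2 / 2) * hW - f' t * hexp t
end

section
/- Fix a₃ ∈ ℝ, λ with 0 < λ < 1/2, and C with 0 < C < 1. Let h₀ : [a₃, ∞) → ℝ be the solution of h₀'(t) = exp(−h₀(t)²/2), h₀(a₃) = √(−2·log λ), and let f_C : [a₃, ∞) → ℝ be the solution of f_C''(t) = C·exp(−h₀(t)²)·f_C(t), f_C(a₃) = 1, f_C'(a₃) = 0. Then f_C(t) → ∞ and f_C'(t) → ∞ as t → ∞. -/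
open Set Filter Real

/-- A function with nonnegative one-sided derivative on `[a, ∞)` is monotone there. -/
theorem monotoneOn_Ici_of_hasDerivWithinAt_nonneg {g g' : ℝ → ℝ} {a : ℝ}
    (hg : ∀ t ∈ Ici a, HasDerivWithinAt g (g' t) (Ici a) t) (hg' : ∀ t ∈ Ici a, 0 ≤ g' t) :
    MonotoneOn g (Ici a) :=
  monotoneOn_of_hasDerivWithinAt_nonneg (convex_Ici a) (fun t ht => (hg t ht).continuousWithinAt)
    (fun t ht => (hg t (interior_subset ht)).mono interior_subset)
    fun t ht => hg' t (interior_subset ht)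

/-- A solution of `f'' = q f` with `q ≥ 0`, `f a = 1`, `f' a = 0` stays at or above `1`. -/
theorem one_le_of_second_order_ode {f f' q : ℝ → ℝ} {a : ℝ} (hq : ∀ t ∈ Ici a, 0 ≤ q t)
    (ha : f a = 1) (ha' : f' a = 0)
    (hf : ∀ t ∈ Ici a, HasDerivWithinAt f (f' t) (Ici a) t)
    (hf' : ∀ t ∈ Ici a, HasDerivWithinAt f' (q t * f t) (Ici a) t) :
    ∀ t ∈ Ici a, 1 ≤ f t := by
  have hprod : ∀ t ∈ Ici a, 0 ≤ f t * f' t := by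
    intro t ht
    have hmono := monotoneOn_Ici_of_hasDerivWithinAt_nonneg
      (fun s hs => (hf s hs).mul (hf' s hs)) fun s hs => by
        have := mul_nonneg (hq s hs) (sq_nonneg (f s))
        nlinarith [sq_nonneg (f' s)]
    simpa [ha, ha'] using hmono self_mem_Ici ht ht
  have hsq : ∀ t ∈ Ici a, 1 ≤ f t ^ 2 := by
    intro t ht
    have hmono := monotoneOn_Ici_of_hasDerivWithinAt_nonneg
      (fun s hs => (hf s hs).pow 2) fun s hs => by
        have := hprod s hs
        norm_num
        linarith
    simpa [ha] using hmono self_mem_Ici ht ht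
  intro t ht
  by_contra! hlt
  have hneg : f t ≤ 0 := by nlinarith [hsq t ht]
  have hcont : ContinuousOn f (Icc a t) := fun s hs =>
    (hf s hs.1).continuousWithinAt.mono Icc_subset_Ici_self
  obtain ⟨s, hs, hs0⟩ := intermediate_value_Icc' ht hcont ⟨hneg, by rw [ha]; exact zero_le_one⟩
  have := hsq s hs.1
  norm_num [hs0] at this

/-- For a solution of `h' = exp (-h² / 2)`, the derivative of `exp (h² / 2)` is `h`. -/
theorem hasDerivWithinAt_exp_sq_div_two {h : ℝ → ℝ} {s : Set ℝ} {t : ℝ}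
    (hh : HasDerivWithinAt h (exp (-(h t) ^ 2 / 2)) s t) :
    HasDerivWithinAt (fun t => exp (h t ^ 2 / 2)) (h t) s t := by
  have hmul : exp (h t ^ 2 / 2) * exp (-(h t) ^ 2 / 2) = 1 := by
    rw [← exp_add, ← exp_zero]
    congr 1
    ring
  convert ((hh.pow 2).div_const 2).exp using 1
  simp only [Pi.pow_apply]
  linear_combination (-h t) * hmul

theorem monotoneOn_of_gaussian_ode {h : ℝ → ℝ} {a : ℝ}
    (hh : ∀ t ∈ Ici a, HasDerivWithinAt h (exp (-(h t) ^ 2 / 2)) (Ici a) t) :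
    MonotoneOn h (Ici a) :=
  monotoneOn_Ici_of_hasDerivWithinAt_nonneg hh fun _ _ => (exp_pos _).le

theorem tendsto_atTop_of_gaussian_ode {h : ℝ → ℝ} {a : ℝ}
    (hh : ∀ t ∈ Ici a, HasDerivWithinAt h (exp (-(h t) ^ 2 / 2)) (Ici a) t) (ha : 0 < h a) :
    Tendsto h atTop atTop := by
  have hle : ∀ t ∈ Ici a, h a ≤ h t := fun t ht =>
    monotoneOn_of_gaussian_ode hh self_mem_Ici ht ht
  have hgrow : ∀ t ∈ Ici a, h a * (t - a) ≤ exp (h t ^ 2 / 2) := by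
    intro t ht
    have hmono := monotoneOn_Ici_of_hasDerivWithinAt_nonneg
      (fun s hs => (hasDerivWithinAt_exp_sq_div_two (hh s hs)).sub
        (((hasDerivWithinAt_id s (Ici a)).sub_const a).const_mul (h a))) fun s hs => by
        linarith [hle s hs]
    have := hmono self_mem_Ici ht ht
    simp only [Pi.sub_apply, id, sub_self, mul_zero, sub_zero] at this
    linarith [exp_pos (h a ^ 2 / 2)]
  have hlin : Tendsto (fun t => h a * (t - a)) atTop atTop :=
    (tendsto_atTop_add_const_right _ (-a) tendsto_id).const_mul_atTop ha
  refine tendsto_atTop.2 fun M => ?_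
  filter_upwards [hlin.eventually_gt_atTop (exp (M ^ 2 / 2)), eventually_ge_atTop a] with t hM ht
  by_contra! hlt
  have hlt' := exp_lt_exp.1 (hM.trans_le (hgrow t ht))
  nlinarith [hle t ht]

/-- Along a positive solution of `h' = exp (-h² / 2)`, `exp (h² / 2)` is `O (h t * t)`. -/
theorem exists_exp_sq_div_two_le {h : ℝ → ℝ} {a : ℝ}
    (hh : ∀ t ∈ Ici a, HasDerivWithinAt h (exp (-(h t) ^ 2 / 2)) (Ici a) t) (ha : 0 < h a) :
    ∃ K > 0, ∀ t ∈ Ici (a + 1), exp (h t ^ 2 / 2) ≤ K * (h t * (t - a)) := by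
  have hle : ∀ t ∈ Ici a, h a ≤ h t := fun t ht =>
    monotoneOn_of_gaussian_ode hh self_mem_Ici ht ht
  refine ⟨1 + exp (h a ^ 2 / 2) / h a, by positivity, fun t ht => ?_⟩
  rw [mem_Ici] at ht
  have hta : t ∈ Ici a := by rw [mem_Ici]; linarith
  have hmono := monotoneOn_Ici_of_hasDerivWithinAt_nonneg
    (fun s hs => ((hh s hs).mul ((hasDerivWithinAt_id s (Ici a)).sub_const a)).sub
      (hasDerivWithinAt_exp_sq_div_two (hh s hs))) fun s hs => by
      have := mul_nonneg (exp_pos (-(h s) ^ 2 / 2)).le (sub_nonneg.2 hs)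
      simp only [id]
      linarith
  have hdiff := hmono self_mem_Ici hta hta
  simp only [Pi.sub_apply, Pi.mul_apply, id, sub_self, mul_zero, zero_sub] at hdiff
  have hprod : h a ≤ h t * (t - a) := by nlinarith [hle t hta]
  have hinit : exp (h a ^ 2 / 2) ≤ exp (h a ^ 2 / 2) / h a * (h t * (t - a)) := by
    rw [div_mul_eq_mul_div, le_div_iff₀ ha]
    exact mul_le_mul_of_nonneg_left hprod (exp_pos _).le
  linarith

/-- Fix `a₃ ∈ ℝ`, `0 < λ < 1/2`, `0 < C < 1`.  Let `h₀` solve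
`h₀' t = exp (-(h₀ t)²/2)`, `h₀ a₃ = √(-2 log λ)` on `[a₃, ∞)`, and let `f` (with
derivative `f'`) solve `f'' t = C · exp (-(h₀ t)²) · f t`, `f a₃ = 1`, `f' a₃ = 0`.
Then `f t → ∞` and `f' t → ∞` as `t → ∞`. -/
theorem stmt_9 (a₃ lam C : ℝ) (hlam₀ : 0 < lam) (hlam₁ : lam < 1 / 2)
    (hC₀ : 0 < C) (hC₁ : C < 1)
    (h₀ : ℝ → ℝ) (h₀init : h₀ a₃ = Real.sqrt (-2 * Real.log lam))
    (h₀ODE : ∀ t ∈ Set.Ici a₃,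
      HasDerivWithinAt h₀ (Real.exp (-(h₀ t) ^ 2 / 2)) (Set.Ici a₃) t)
    (f f' : ℝ → ℝ) (finit : f a₃ = 1) (f'init : f' a₃ = 0)
    (fODE : ∀ t ∈ Set.Ici a₃, HasDerivWithinAt f (f' t) (Set.Ici a₃) t)
    (f'ODE : ∀ t ∈ Set.Ici a₃,
      HasDerivWithinAt f' (C * Real.exp (-(h₀ t) ^ 2) * f t) (Set.Ici a₃) t) :
    Filter.Tendsto f Filter.atTop Filter.atTop ∧
      Filter.Tendsto f' Filter.atTop Filter.atTop := by
  have hpos : 0 < h₀ a₃ := by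
    rw [h₀init]
    have := log_neg hlam₀ (by linarith)
    exact sqrt_pos.2 (by linarith)
  have hh_pos : ∀ t ∈ Ici a₃, 0 < h₀ t := fun t ht =>
    hpos.trans_le (monotoneOn_of_gaussian_ode h₀ODE self_mem_Ici ht ht)
  have hf_one : ∀ t ∈ Ici a₃, 1 ≤ f t :=
    one_le_of_second_order_ode (fun t _ => by positivity) finit f'init fODE f'ODE
  have hsub : Ici (a₃ + 1) ⊆ Ici a₃ := Ici_subset_Ici.2 (by linarith)
  have hstrict : StrictMonoOn f' (Ici a₃) :=
    strictMonoOn_of_hasDerivWithinAt_pos (convex_Ici a₃)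
      (fun t ht => (f'ODE t ht).continuousWithinAt)
      (fun t ht => (f'ODE t (interior_subset ht)).mono interior_subset) fun t ht => by
        have := hf_one t (interior_subset ht)
        positivity
  have hmem : a₃ + 1 ∈ Ici a₃ := hsub self_mem_Ici
  have hslope : 0 < f' (a₃ + 1) := by
    rw [← f'init]
    exact hstrict self_mem_Ici hmem (by linarith)
  -- `f` grows at least linearly.
  obtain ⟨ε, hε, hlin⟩ : ∃ ε > 0, ∀ t ∈ Ici (a₃ + 1), ε * (t - a₃) ≤ f t := by
    refine ⟨min (f' (a₃ + 1)) 1, lt_min hslope one_pos, fun t ht => ?_⟩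
    have hmono := monotoneOn_Ici_of_hasDerivWithinAt_nonneg
      (fun s hs => ((fODE s (hsub hs)).mono hsub).sub
        ((hasDerivWithinAt_id s (Ici (a₃ + 1))).const_mul (f' (a₃ + 1)))) fun s hs => by
        linarith [hstrict.monotoneOn hmem (hsub hs) hs]
    have hdiff := hmono self_mem_Ici ht ht
    simp only [Pi.sub_apply, id] at hdiff
    rw [mem_Ici] at ht
    have := mul_le_mul_of_nonneg_right (min_le_left (f' (a₃ + 1)) 1)
      (show 0 ≤ t - (a₃ + 1) by linarith)
    linarith [hf_one _ hmem, min_le_right (f' (a₃ + 1)) 1]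
  refine ⟨?_, ?_⟩
  · refine tendsto_atTop_mono' _ ?_
      ((tendsto_atTop_add_const_right _ (-a₃) tendsto_id).const_mul_atTop hε)
    filter_upwards [eventually_ge_atTop (a₃ + 1)] with t ht using hlin t ht
  obtain ⟨K, hK, hexp⟩ := exists_exp_sq_div_two_le h₀ODE hpos
  have hk : 0 < C * ε / K := by positivity
  -- `f'` dominates a multiple of `log h₀`.
  have hmono := monotoneOn_Ici_of_hasDerivWithinAt_nonneg
    (fun s hs => ((f'ODE s (hsub hs)).mono hsub).sub
      ((((h₀ODE s (hsub hs)).mono hsub).log (hh_pos s (hsub hs)).ne').const_mul (C * ε / K)))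
    fun s hs => by
      have hhs := hh_pos s (hsub hs)
      have hsq : exp (-(h₀ s) ^ 2) = exp (-(h₀ s) ^ 2 / 2) * exp (-(h₀ s) ^ 2 / 2) := by
        rw [← exp_add]
        congr 1
        ring
      have hone : exp (h₀ s ^ 2 / 2) * exp (-(h₀ s) ^ 2 / 2) = 1 := by
        rw [← exp_add, ← exp_zero]
        congr 1
        ring
      have hbound : 1 / (K * h₀ s) ≤ exp (-(h₀ s) ^ 2 / 2) * (s - a₃) := by
        rw [div_le_iff₀ (by positivity)]
        have := mul_le_mul_of_nonneg_right (hexp s hs) (exp_pos (-(h₀ s) ^ 2 / 2)).le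
        linarith
      rw [sub_nonneg, hsq]
      calc C * ε / K * (exp (-(h₀ s) ^ 2 / 2) / h₀ s)
          = C * ε * exp (-(h₀ s) ^ 2 / 2) * (1 / (K * h₀ s)) := by field_simp
        _ ≤ C * ε * exp (-(h₀ s) ^ 2 / 2) * (exp (-(h₀ s) ^ 2 / 2) * (s - a₃)) := by gcongr
        _ = C * (exp (-(h₀ s) ^ 2 / 2) * exp (-(h₀ s) ^ 2 / 2)) * (ε * (s - a₃)) := by ring
        _ ≤ _ := by
          gcongr
          exact hlin s hs
  refine tendsto_atTop_mono' _ ?_ (tendsto_atTop_add_const_right _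
    (f' (a₃ + 1) - C * ε / K * log (h₀ (a₃ + 1))) ((tendsto_log_atTop.comp
      (tendsto_atTop_of_gaussian_ode h₀ODE hpos)).const_mul_atTop hk))
  filter_upwards [eventually_ge_atTop (a₃ + 1)] with t ht
  have hdiff := hmono self_mem_Ici ht ht
  simp only [Pi.sub_apply] at hdiff
  simp only [Function.comp_apply]
  linarith
end

section
/- Fix a₃ ∈ ℝ, λ with 0 < λ < 1/2, and C with 0 < C < 1. Let h₀ : [a₃, ∞) → ℝ be the solution of h₀'(t) = exp(−h₀(t)²/2), h₀(a₃) = √(−2·log λ), and let f_C : [a₃, ∞) → ℝ be the solution of f_C''(t) = C·exp(−h₀(t)²)·f_C(t), f_C(a₃) = 1, f_C'(a₃) = 0. Then f_C(t)·h₀'(t) → 0 as t → ∞. -/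
open Filter Set

/-- A function on `[a, ∞)` with nonnegative one-sided derivative is monotone. -/
lemma monotoneOn_Ici_of_hasDerivWithinAt_nonneg_s10 {a : ℝ} {F F' : ℝ → ℝ}
    (hF : ∀ t ∈ Ici a, HasDerivWithinAt F (F' t) (Ici a) t) (hF' : ∀ t ∈ Ici a, 0 ≤ F' t) :
    MonotoneOn F (Ici a) :=
  monotoneOn_of_hasDerivWithinAt_nonneg (convex_Ici a) (fun t ht => (hF t ht).continuousWithinAt)
    (fun t ht => (hF t (interior_subset ht)).mono interior_subset)
    fun t ht => hF' t (interior_subset ht)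

/-- A solution of `f'' = q f` with `q ≥ 0`, `f a = 1` and `f' a = 0` is positive on `[a, ∞)`. -/
lemma pos_of_hasDerivWithinAt_of_nonneg_potential {a : ℝ} {f f' q : ℝ → ℝ}
    (hq : ∀ t ∈ Ici a, 0 ≤ q t) (fa : f a = 1) (f'a : f' a = 0)
    (hf : ∀ t ∈ Ici a, HasDerivWithinAt f (f' t) (Ici a) t)
    (hf' : ∀ t ∈ Ici a, HasDerivWithinAt f' (q t * f t) (Ici a) t) :
    ∀ t ∈ Ici a, 0 < f t := by
  have prod_mono : MonotoneOn (fun t => f t * f' t) (Ici a) :=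
    monotoneOn_Ici_of_hasDerivWithinAt_nonneg_s10 (fun t ht => (hf t ht).mul (hf' t ht))
      fun t ht => by nlinarith [mul_nonneg (hq t ht) (sq_nonneg (f t)), sq_nonneg (f' t)]
  have prod_nonneg : ∀ t ∈ Ici a, 0 ≤ f t * f' t := fun t ht => by
    simpa [f'a] using prod_mono self_mem_Ici ht ht
  have sq_mono : MonotoneOn (fun t => f t * f t) (Ici a) :=
    monotoneOn_Ici_of_hasDerivWithinAt_nonneg_s10 (fun t ht => (hf t ht).mul (hf t ht))
      fun t ht => by nlinarith [prod_nonneg t ht]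
  intro t ht
  by_contra! hneg
  have hcont : ContinuousOn f (Icc a t) := fun s hs =>
    ((hf s hs.1).continuousWithinAt).mono Icc_subset_Ici_self
  obtain ⟨s, hs, hs0⟩ := intermediate_value_Icc' (mem_Ici.1 ht) hcont ⟨hneg, by simp [fa]⟩
  have := sq_mono self_mem_Ici hs.1 hs.1
  norm_num [fa, hs0] at this

section

variable {a : ℝ} {h : ℝ → ℝ}

lemma hasDerivWithinAt_exp_half_sq
    (hh : ∀ t ∈ Ici a, HasDerivWithinAt h (Real.exp (-(h t) ^ 2 / 2)) (Ici a) t) :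
    ∀ t ∈ Ici a, HasDerivWithinAt (fun t => Real.exp ((h t) ^ 2 / 2)) (h t) (Ici a) t := by
  intro t ht
  have := (((hh t ht).pow 2).div_const 2).exp
  refine this.congr_deriv ?_
  have : Real.exp ((h t) ^ 2 / 2) * Real.exp (-(h t) ^ 2 / 2) = 1 := by
    rw [← Real.exp_add]; ring_nf; simp
  push_cast
  simp only [Pi.pow_apply]
  linear_combination (h t) * this

lemma hasDerivWithinAt_exp_neg_half_sq
    (hh : ∀ t ∈ Ici a, HasDerivWithinAt h (Real.exp (-(h t) ^ 2 / 2)) (Ici a) t) :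
    ∀ t ∈ Ici a, HasDerivWithinAt (fun t => Real.exp (-(h t) ^ 2 / 2))
      (-h t * Real.exp (-(h t) ^ 2 / 2) ^ 2) (Ici a) t := by
  intro t ht
  have := ((((hh t ht).pow 2).neg).div_const 2).exp
  refine this.congr_deriv ?_
  push_cast
  simp only [Pi.pow_apply, Pi.neg_apply]
  ring

lemma le_of_hasDerivWithinAt_exp
    (hh : ∀ t ∈ Ici a, HasDerivWithinAt h (Real.exp (-(h t) ^ 2 / 2)) (Ici a) t) :
    ∀ t ∈ Ici a, h a ≤ h t := fun _ ht =>
  monotoneOn_Ici_of_hasDerivWithinAt_nonneg_s10 hh (fun _ _ => (Real.exp_pos _).le)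
    self_mem_Ici ht ht

lemma tendsto_exp_half_sq_atTop (ha : 0 < h a)
    (hh : ∀ t ∈ Ici a, HasDerivWithinAt h (Real.exp (-(h t) ^ 2 / 2)) (Ici a) t) :
    Tendsto (fun t => Real.exp ((h t) ^ 2 / 2)) atTop atTop := by
  have mono : MonotoneOn (fun t => Real.exp ((h t) ^ 2 / 2) - t * h a) (Ici a) :=
    monotoneOn_Ici_of_hasDerivWithinAt_nonneg_s10
      (fun t ht => (hasDerivWithinAt_exp_half_sq hh t ht).sub
        ((hasDerivWithinAt_id t _).mul_const (h a)))
      fun t ht => by linarith [le_of_hasDerivWithinAt_exp hh t ht]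
  refine tendsto_atTop_mono' atTop ?_ (tendsto_atTop_add_const_right atTop
    (Real.exp ((h a) ^ 2 / 2) - a * h a) (tendsto_id.atTop_mul_const ha))
  filter_upwards [Ici_mem_atTop a] with t ht
  have := mono self_mem_Ici ht ht
  simp only [id] at this ⊢
  linarith

lemma tendsto_atTop_of_hasDerivWithinAt_exp (ha : 0 < h a)
    (hh : ∀ t ∈ Ici a, HasDerivWithinAt h (Real.exp (-(h t) ^ 2 / 2)) (Ici a) t) :
    Tendsto h atTop atTop := by
  have sq_tendsto : Tendsto (fun t => (h t) ^ 2 / 2) atTop atTop :=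
    Real.tendsto_exp_comp_atTop.1 (tendsto_exp_half_sq_atTop ha hh)
  refine (Real.tendsto_sqrt_atTop.comp (sq_tendsto.const_mul_atTop two_pos)).congr' ?_
  filter_upwards [Ici_mem_atTop a] with t ht
  have : 0 ≤ h t := ha.le.trans (le_of_hasDerivWithinAt_exp hh t ht)
  simp only [Function.comp]
  rw [mul_div_cancel₀ _ two_ne_zero, Real.sqrt_sq this]

/-- Eventually `h' ≥ 1 / (2 h (t - a))`. -/
lemma eventually_half_le_mul_exp_neg_half_sq (ha : 0 < h a)
    (hh : ∀ t ∈ Ici a, HasDerivWithinAt h (Real.exp (-(h t) ^ 2 / 2)) (Ici a) t) :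
    ∀ᶠ t in atTop, 1 / 2 ≤ h t * (t - a) * Real.exp (-(h t) ^ 2 / 2) := by
  have mono : MonotoneOn (fun t => h t * (t - a) - Real.exp ((h t) ^ 2 / 2)) (Ici a) :=
    monotoneOn_Ici_of_hasDerivWithinAt_nonneg_s10
      (fun t ht => ((hh t ht).mul ((hasDerivWithinAt_id t _).sub_const a)).sub
        (hasDerivWithinAt_exp_half_sq hh t ht))
      fun t ht => by
        simp only [id, mul_one, add_sub_cancel_right]
        exact mul_nonneg (Real.exp_pos _).le (sub_nonneg.2 ht)
  filter_upwards [Ici_mem_atTop a, (tendsto_exp_half_sq_atTop ha hh).eventually_ge_atTop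
    (2 * Real.exp ((h a) ^ 2 / 2))] with t ht hlarge
  have key := mono self_mem_Ici ht ht
  simp only [sub_self, mul_zero, zero_sub] at key
  have hprod : Real.exp ((h t) ^ 2 / 2) * Real.exp (-(h t) ^ 2 / 2) = 1 := by
    rw [← Real.exp_add]; ring_nf; simp
  have := mul_le_mul_of_nonneg_right
    (show Real.exp ((h t) ^ 2 / 2) / 2 ≤ h t * (t - a) by linarith)
    (Real.exp_pos (-(h t) ^ 2 / 2)).le
  linarith

end

/-- Fix `a₃ ∈ ℝ`, `0 < λ < 1/2`, `0 < C < 1`.  Let `h₀` solve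
`h₀' t = exp (-(h₀ t)²/2)`, `h₀ a₃ = √(-2 log λ)` on `[a₃, ∞)`, and let `f` (with
derivative `f'`) solve `f'' t = C · exp (-(h₀ t)²) · f t`, `f a₃ = 1`, `f' a₃ = 0`.
Then `f t · h₀' t → 0` as `t → ∞` (here `h₀' t = exp (-(h₀ t)²/2)`). -/
theorem stmt_10 (a₃ lam C : ℝ) (hlam₀ : 0 < lam) (hlam₁ : lam < 1 / 2)
    (hC₀ : 0 < C) (hC₁ : C < 1)
    (h₀ : ℝ → ℝ) (h₀init : h₀ a₃ = Real.sqrt (-2 * Real.log lam))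
    (h₀ODE : ∀ t ∈ Set.Ici a₃,
      HasDerivWithinAt h₀ (Real.exp (-(h₀ t) ^ 2 / 2)) (Set.Ici a₃) t)
    (f f' : ℝ → ℝ) (finit : f a₃ = 1) (f'init : f' a₃ = 0)
    (fODE : ∀ t ∈ Set.Ici a₃, HasDerivWithinAt f (f' t) (Set.Ici a₃) t)
    (f'ODE : ∀ t ∈ Set.Ici a₃,
      HasDerivWithinAt f' (C * Real.exp (-(h₀ t) ^ 2) * f t) (Set.Ici a₃) t) :
    Filter.Tendsto (fun t => f t * Real.exp (-(h₀ t) ^ 2 / 2))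
      Filter.atTop (nhds 0) := by
  have ha : 0 < h₀ a₃ := by
    rw [h₀init]
    exact Real.sqrt_pos.2 (by linarith [Real.log_neg hlam₀ (by linarith)])
  have hpos : ∀ t ∈ Ici a₃, 0 < h₀ t := fun t ht =>
    ha.trans_le (le_of_hasDerivWithinAt_exp h₀ODE t ht)
  have fpos : ∀ t ∈ Ici a₃, 0 < f t :=
    pos_of_hasDerivWithinAt_of_nonneg_potential
      (fun t _ => mul_nonneg hC₀.le (Real.exp_pos _).le) finit f'init fODE f'ODE
  set g : ℝ → ℝ := fun t => Real.exp (-(h₀ t) ^ 2 / 2) with hg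
  have gpos : ∀ t, 0 < g t := fun t => Real.exp_pos _
  have exp_mul_g : ∀ t, Real.exp ((h₀ t) ^ 2 / 2) * g t = 1 := fun t => by
    rw [hg, ← Real.exp_add]; ring_nf; simp
  have g_sq : ∀ t, Real.exp (-(h₀ t) ^ 2) = g t ^ 2 := fun t => by
    rw [hg, ← Real.exp_nat_mul]; ring_nf
  -- `v` is `exp (h₀² / 2)` times the derivative of `u = f g` with respect to `h₀`.
  set v : ℝ → ℝ := fun t => f' t * Real.exp ((h₀ t) ^ 2 / 2) - h₀ t * f t with hv
  have vderiv : ∀ t ∈ Ici a₃, HasDerivWithinAt v (-((1 - C) * (f t * g t))) (Ici a₃) t := by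
    intro t ht
    refine (((f'ODE t ht).mul (hasDerivWithinAt_exp_half_sq h₀ODE t ht)).sub
      ((h₀ODE t ht).mul (fODE t ht))).congr_deriv ?_
    rw [g_sq]
    linear_combination C * g t * f t * exp_mul_g t
  have uderiv : ∀ t ∈ Ici a₃,
      HasDerivWithinAt (fun t => f t * g t) (g t ^ 2 * v t) (Ici a₃) t := by
    intro t ht
    refine ((fODE t ht).mul (hasDerivWithinAt_exp_neg_half_sq h₀ODE t ht)).congr_deriv ?_
    linear_combination (-f' t * g t) * exp_mul_g t
  have upos : ∀ t ∈ Ici a₃, 0 < f t * g t := fun t ht => mul_pos (fpos t ht) (gpos t)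
  have va : v a₃ ≤ 0 := by simp [hv, f'init, finit, ha.le]
  have v_le : ∀ L, (∀ t ∈ Ici a₃, L ≤ f t * g t) → ∀ t ∈ Ici a₃,
      v t ≤ -((1 - C) * L * (t - a₃)) := by
    intro L hL t ht
    have mono := monotoneOn_Ici_of_hasDerivWithinAt_nonneg_s10
      (fun t ht => ((vderiv t ht).neg).sub
        (((hasDerivWithinAt_id t (Ici a₃)).sub_const a₃).const_mul ((1 - C) * L)))
      (fun t ht => by nlinarith [hL t ht]) self_mem_Ici ht ht
    simp only [Pi.sub_apply, Pi.neg_apply, id, sub_self, mul_zero] at mono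
    linarith
  have uanti : AntitoneOn (fun t => f t * g t) (Ici a₃) := by
    have := monotoneOn_Ici_of_hasDerivWithinAt_nonneg_s10 (fun t ht => (uderiv t ht).neg)
      fun t ht => by
        have := v_le 0 (fun t ht => (upos t ht).le) t ht
        nlinarith [sq_nonneg (g t)]
    simpa using this.neg
  have usmall : ∀ L > 0, ∃ t ∈ Ici a₃, f t * g t < L := by
    intro L hLpos
    by_contra! hL
    obtain ⟨T, hT⟩ := eventually_atTop.1 ((eventually_ge_atTop a₃).and
      (eventually_half_le_mul_exp_neg_half_sq ha h₀ODE))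
    have haT : a₃ ≤ T := (hT T le_rfl).1
    have cpos : 0 < (1 - C) * L := mul_pos (by linarith) hLpos
    have hsub : Ici T ⊆ Ici a₃ := Ici_subset_Ici.2 haT
    have mono := monotoneOn_Ici_of_hasDerivWithinAt_nonneg_s10 (a := T)
      (fun t ht => (((uderiv t (hsub ht)).add
        (((h₀ODE t (hsub ht)).log (hpos t (hsub ht)).ne').const_mul ((1 - C) * L / 2))).neg).mono
          hsub)
      fun t ht => by
        have ht' := hsub ht
        have hh := hpos t ht'
        have hlow : 1 / 2 / h₀ t ≤ (t - a₃) * g t := by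
          rw [div_le_iff₀ hh]
          linarith [(hT t ht).2]
        have hmul := mul_le_mul_of_nonneg_left hlow (mul_pos cpos (gpos t)).le
        have hvt := mul_le_mul_of_nonneg_left (v_le L hL t ht') (sq_nonneg (g t))
        have heq : (1 - C) * L * g t * (1 / 2 / h₀ t) = (1 - C) * L / 2 * (g t / h₀ t) := by
          ring
        change 0 ≤ -(g t ^ 2 * v t + (1 - C) * L / 2 * (g t / h₀ t))
        linarith
    have log_tendsto : Tendsto (fun t => (1 - C) * L / 2 * Real.log (h₀ t)) atTop atTop :=
      (Real.tendsto_log_atTop.comp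
        (tendsto_atTop_of_hasDerivWithinAt_exp ha h₀ODE)).const_mul_atTop (half_pos cpos)
    obtain ⟨t, ht, htT⟩ := ((log_tendsto.eventually_gt_atTop
      (f T * g T + (1 - C) * L / 2 * Real.log (h₀ T))).and (eventually_ge_atTop T)).exists
    have hle := mono self_mem_Ici (mem_Ici.2 htT) htT
    simp only [Pi.neg_apply, Pi.add_apply] at hle
    linarith [upos t (hsub htT)]
  refine tendsto_order.2 ⟨fun b hb => ?_, fun L hL => ?_⟩
  · filter_upwards [Ici_mem_atTop a₃] with t ht using hb.trans (upos t ht)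
  · obtain ⟨T, hT, hTL⟩ := usmall L hL
    filter_upwards [eventually_ge_atTop T] with t ht
    exact (uanti hT (mem_Ici.2 (le_trans hT ht)) ht).trans_lt hTL
end

section
/- Fix c > 0 and t₀ ∈ ℝ. Let f, φ : ℝ → ℝ and F : ℝ → ℝ be functions and assume: f(s) = c·sin(F(φ(s))/c) for all s in some neighbourhood of t₀; φ is differentiable at t₀ with φ'(t₀) > 0; F is differentiable at φ(t₀); 0 < F(φ(t₀)) < c·π/2; and the unit-speed condition φ'(t₀)²·(1 + F'(φ(t₀))²) = 1 holds. Then f is differentiable at t₀ and: (i) f'(t₀)² < 1 − f(t₀)²/c²; (ii) F'(φ(t₀)) = f'(t₀)/√(1 − f(t₀)²/c² − f'(t₀)²); (iii) φ'(t₀) = √((1 − f(t₀)²/c² − f'(t₀)²)/(1 − f(t₀)²/c²)), equivalently √(1 + F'(φ(t₀))²) = 1/φ'(t₀). -/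
/-- Fix `c > 0` and `t₀ ∈ ℝ`.  Suppose `f s = c · sin (F (φ s) / c)`
near `t₀`, `φ` is differentiable at `t₀` with derivative `φ'₀ > 0`, `F` is differentiable
at `φ t₀` with derivative `F'₀`, `0 < F (φ t₀) < c π / 2`, and the unit-speed condition
`φ'₀² (1 + F'₀²) = 1` holds.  Then `f` is differentiable at `t₀` with derivative `d` and
(i) `d² < 1 - f(t₀)²/c²`; (ii) `F'₀ = d / √(1 - f(t₀)²/c² - d²)`;
(iii) `φ'₀ = √((1 - f(t₀)²/c² - d²)/(1 - f(t₀)²/c²))`, equivalently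
`√(1 + F'₀²) = 1/φ'₀`. -/
theorem stmt_11 (c t₀ : ℝ) (hc : 0 < c) (f φ F : ℝ → ℝ) (φ'₀ F'₀ : ℝ)
    (hloc : ∀ᶠ s in nhds t₀, f s = c * Real.sin (F (φ s) / c))
    (hφ : HasDerivAt φ φ'₀ t₀) (hφpos : 0 < φ'₀)
    (hF : HasDerivAt F F'₀ (φ t₀))
    (hF₀ : 0 < F (φ t₀)) (hF₁ : F (φ t₀) < c * Real.pi / 2)
    (hunit : φ'₀ ^ 2 * (1 + F'₀ ^ 2) = 1) :
    ∃ d : ℝ, HasDerivAt f d t₀ ∧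
      d ^ 2 < 1 - (f t₀) ^ 2 / c ^ 2 ∧
      F'₀ = d / Real.sqrt (1 - (f t₀) ^ 2 / c ^ 2 - d ^ 2) ∧
      φ'₀ = Real.sqrt ((1 - (f t₀) ^ 2 / c ^ 2 - d ^ 2) / (1 - (f t₀) ^ 2 / c ^ 2)) ∧
      Real.sqrt (1 + F'₀ ^ 2) = 1 / φ'₀ := by
  set θ := F (φ t₀) / c with hθ
  have hcos : 0 < Real.cos θ := by
    apply Real.cos_pos_of_mem_Ioo
    have hpos : 0 < θ := div_pos hF₀ hc
    refine ⟨by linarith [Real.pi_pos], ?_⟩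
    rw [hθ, div_lt_iff₀ hc]
    linarith
  have hderiv : HasDerivAt f (Real.cos θ * (F'₀ * φ'₀)) t₀ := by
    have h := (((hF.comp t₀ hφ).div_const c).sin.const_mul c).congr_of_eventuallyEq hloc
    refine h.congr_deriv ?_
    change c * (Real.cos θ * (F'₀ * φ'₀ / c)) = _
    field_simp
  have hcos_sq : 1 - f t₀ ^ 2 / c ^ 2 = Real.cos θ ^ 2 := by
    rw [hloc.self_of_nhds, Real.cos_sq', mul_pow, mul_div_cancel_left₀ _ (by positivity)]
  have hdiff : Real.cos θ ^ 2 - (Real.cos θ * (F'₀ * φ'₀)) ^ 2 = (Real.cos θ * φ'₀) ^ 2 := by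
    linear_combination (-Real.cos θ ^ 2) * hunit
  refine ⟨Real.cos θ * (F'₀ * φ'₀), hderiv, ?_, ?_, ?_, ?_⟩
  · rw [hcos_sq]
    have : 0 < (Real.cos θ * φ'₀) ^ 2 := by positivity
    linarith
  · rw [hcos_sq, hdiff, Real.sqrt_sq (by positivity)]
    field_simp
  · rw [hcos_sq, hdiff, ← div_pow, mul_div_cancel_left₀ _ hcos.ne', Real.sqrt_sq hφpos.le]
  · rw [show 1 + F'₀ ^ 2 = (1 / φ'₀) ^ 2 by field_simp; linarith,
      Real.sqrt_sq (by positivity)]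
end

section
/- Fix c > 0 and real numbers a₃ < b₃. Let f : [a₃, b₃] → ℝ be continuously differentiable with 0 < f(t) < c and f'(t)² < 1 − f(t)²/c² for all t ∈ [a₃, b₃]. Then there exists a unique pair (φ, F) consisting of a continuously differentiable function φ : [a₃, b₃] → ℝ with φ(a₃) = a₃ and φ'(t) > 0 for all t, and a differentiable function F defined on the image of φ with values in (0, c·π/2), such that for all t ∈ [a₃, b₃]: f(t) = c·sin(F(φ(t))/c) and φ'(t)²·(1 + F'(φ(t))²) = 1. Moreover φ and F are given explicitly by φ(t) = a₃ + ∫_{a₃}^{t} √((1 − f(s)²/c² − f'(s)²)/(1 − f(s)²/c²)) ds and F(φ(t)) = c·arcsin(f(t)/c). -/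
/-- The reparametrization data of Section 9 of the paper (with `c = βN`): a continuously
differentiable `φ` on `[a₃, b₃]` with `φ a₃ = a₃` and `φ' > 0` (derivative function `φ'`),
and a differentiable profile function `F` on the image of `φ` with values in
`(0, c·π/2)` (derivative function `F'`), such that `f t = c · sin (F (φ t) / c)` and the
unit-speed condition `(φ' t)² · (1 + (F' (φ t))²) = 1` hold on `[a₃, b₃]`. -/
def IsReparam (c a₃ b₃ : ℝ) (f φ φ' F F' : ℝ → ℝ) : Prop :=
  φ a₃ = a₃ ∧
  (∀ t ∈ Set.Icc a₃ b₃, HasDerivWithinAt φ (φ' t) (Set.Icc a₃ b₃) t) ∧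
  ContinuousOn φ' (Set.Icc a₃ b₃) ∧
  (∀ t ∈ Set.Icc a₃ b₃, 0 < φ' t) ∧
  (∀ t ∈ Set.Icc a₃ b₃,
    HasDerivWithinAt F (F' (φ t)) (φ '' Set.Icc a₃ b₃) (φ t)) ∧
  (∀ t ∈ Set.Icc a₃ b₃, F (φ t) ∈ Set.Ioo 0 (c * Real.pi / 2)) ∧
  (∀ t ∈ Set.Icc a₃ b₃, f t = c * Real.sin (F (φ t) / c)) ∧
  (∀ t ∈ Set.Icc a₃ b₃, (φ' t) ^ 2 * (1 + (F' (φ t)) ^ 2) = 1)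

open Set

/-- The speed `√((1 - f²/c² - f'²) / (1 - f²/c²))` of the reparametrization. -/
noncomputable def reparamSpeed (c : ℝ) (f f' : ℝ → ℝ) (s : ℝ) : ℝ :=
  Real.sqrt ((1 - (f s) ^ 2 / c ^ 2 - (f' s) ^ 2) / (1 - (f s) ^ 2 / c ^ 2))

section Pointwise

variable {c x p : ℝ}

lemma one_sub_sq_div_sq_pos (h : p ^ 2 < 1 - x ^ 2 / c ^ 2) : 0 < 1 - x ^ 2 / c ^ 2 :=
  (sq_nonneg p).trans_lt h

lemma c_mul_arcsin_mem_Ioo (hc : 0 < c) (h0 : 0 < x) (h1 : x < c) :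
    c * Real.arcsin (x / c) ∈ Ioo 0 (c * Real.pi / 2) := by
  refine ⟨mul_pos hc (Real.arcsin_pos.2 (div_pos h0 hc)), ?_⟩
  rw [mul_div_assoc]
  exact mul_lt_mul_of_pos_left (Real.arcsin_lt_pi_div_two.2 ((div_lt_one hc).2 h1)) hc

lemma eq_c_mul_arcsin {y : ℝ} (hc : 0 < c) (hy : y ∈ Ioo 0 (c * Real.pi / 2))
    (h : x = c * Real.sin (y / c)) : y = c * Real.arcsin (x / c) := by
  have h0 : 0 < y / c := div_pos hy.1 hc
  have h1 : y / c < Real.pi / 2 := by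
    rw [div_lt_iff₀ hc]
    linarith [hy.2]
  rw [h, mul_div_cancel_left₀ _ hc.ne', Real.arcsin_sin (by linarith) h1.le,
    mul_div_cancel₀ _ hc.ne']

lemma hasDerivWithinAt_c_mul_arcsin {f : ℝ → ℝ} {s : Set ℝ} {t : ℝ} (hc : 0 < c)
    (h0 : 0 < f t) (h1 : f t < c) (hf : HasDerivWithinAt f p s t) :
    HasDerivWithinAt (fun u => c * Real.arcsin (f u / c))
      (p / Real.sqrt (1 - f t ^ 2 / c ^ 2)) s t := by
  have hlt : f t / c < 1 := (div_lt_one hc).2 h1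
  have hpos : 0 < f t / c := div_pos h0 hc
  have := ((Real.hasDerivAt_arcsin (by linarith) hlt.ne).comp_hasDerivWithinAt t
    (hf.div_const c)).const_mul c
  refine this.congr_deriv ?_
  rw [div_pow]
  field_simp

end Pointwise

section Speed

variable {c a b : ℝ} {f f' : ℝ → ℝ}

lemma reparamSpeed_pos {t : ℝ} (h : f' t ^ 2 < 1 - f t ^ 2 / c ^ 2) :
    0 < reparamSpeed c f f' t :=
  Real.sqrt_pos.2 (div_pos (by linarith) (one_sub_sq_div_sq_pos h))

lemma reparamSpeed_sq {t : ℝ} (h : f' t ^ 2 < 1 - f t ^ 2 / c ^ 2) :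
    reparamSpeed c f f' t ^ 2 = 1 - (f' t / Real.sqrt (1 - f t ^ 2 / c ^ 2)) ^ 2 := by
  have hpos := one_sub_sq_div_sq_pos h
  rw [reparamSpeed, Real.sq_sqrt (div_nonneg (by linarith) hpos.le), div_pow,
    Real.sq_sqrt hpos.le, sub_div, div_self hpos.ne']

lemma continuousOn_reparamSpeed {s : Set ℝ} (hf : ContinuousOn f s) (hf' : ContinuousOn f' s)
    (h : ∀ t ∈ s, f' t ^ 2 < 1 - f t ^ 2 / c ^ 2) :
    ContinuousOn (reparamSpeed c f f') s := by
  have hden : ContinuousOn (fun t => 1 - f t ^ 2 / c ^ 2) s :=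
    continuousOn_const.sub ((hf.pow 2).div_const _)
  exact ((hden.sub (hf'.pow 2)).div hden
    fun t ht => (one_sub_sq_div_sq_pos (h t ht)).ne').sqrt

/-- In any solution, the profile function is determined along `φ`. -/
lemma IsReparam.profile_eq {φ φ' F F' : ℝ → ℝ} (hc : 0 < c)
    (h : IsReparam c a b f φ φ' F F') {t : ℝ} (ht : t ∈ Icc a b) :
    F (φ t) = c * Real.arcsin (f t / c) := by
  obtain ⟨-, -, -, -, -, hmem, hsin, -⟩ := h
  exact eq_c_mul_arcsin hc (hmem t ht) (hsin t ht)

/-- In any solution, the derivative of `φ` is the speed `reparamSpeed`. -/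
lemma IsReparam.deriv_eq {φ φ' F F' : ℝ → ℝ} (hc : 0 < c) (hab : a < b)
    (hf : ∀ t ∈ Icc a b, HasDerivWithinAt f (f' t) (Icc a b) t)
    (hcond : ∀ t ∈ Icc a b, 0 < f t ∧ f t < c ∧ f' t ^ 2 < 1 - f t ^ 2 / c ^ 2)
    (h : IsReparam c a b f φ φ' F F') {t : ℝ} (ht : t ∈ Icc a b) :
    φ' t = reparamSpeed c f f' t := by
  have hprofile : ∀ u ∈ Icc a b, F (φ u) = c * Real.arcsin (f u / c) :=
    fun u hu => h.profile_eq hc hu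
  obtain ⟨-, hφ, -, hpos, hF, -, -, hunit⟩ := h
  obtain ⟨h0, h1, h2⟩ := hcond t ht
  have hcomp : HasDerivWithinAt (F ∘ φ) (F' (φ t) * φ' t) (Icc a b) t :=
    (hF t ht).comp t (hφ t ht) (mapsTo_image _ _)
  have harcsin : HasDerivWithinAt (F ∘ φ) (f' t / Real.sqrt (1 - f t ^ 2 / c ^ 2)) (Icc a b) t :=
    (hasDerivWithinAt_c_mul_arcsin hc h0 h1 (hf t ht)).congr hprofile (hprofile t ht)
  have hderiv := (uniqueDiffOn_Icc hab t ht).eq_deriv _ hcomp harcsin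
  refine (sq_eq_sq₀ (hpos t ht).le (reparamSpeed_pos h2).le).1 ?_
  rw [reparamSpeed_sq h2, ← hderiv]
  linear_combination hunit t ht

/-- A positive function that is continuous on `[a, b]` has a primitive there which extends to a
function on `ℝ` with a left inverse that is differentiable at the points of the image. -/
lemma exists_primitive_leftInverse {g : ℝ → ℝ} (hab : a ≤ b) (hg : ContinuousOn g (Icc a b))
    (hpos : ∀ t ∈ Icc a b, 0 < g t) :
    ∃ φ ψ : ℝ → ℝ, Function.LeftInverse ψ φ ∧
      (∀ t ∈ Icc a b, φ t = a + ∫ s in a..t, g s) ∧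
      (∀ t ∈ Icc a b, HasDerivAt φ (g t) t) ∧
      ∀ t ∈ Icc a b, HasDerivAt ψ (g t)⁻¹ (φ t) := by
  set G : ℝ → ℝ := IccExtend hab ((Icc a b).domRestrict g)
  have hG : Continuous G := hg.domRestrict.Icc_extend'
  have hGpos : ∀ t, 0 < G t := fun t => hpos _ (projIcc a b hab t).2
  have hGeq : ∀ t ∈ Icc a b, G t = g t := fun t ht => IccExtend_of_mem hab _ ht
  set φ : ℝ → ℝ := fun t => a + ∫ s in a..t, G s
  have hφ : ∀ t, HasStrictDerivAt φ (G t) t := fun t =>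
    (hG.integral_hasStrictDerivAt a t).const_add a
  have hmono : StrictMono φ := strictMono_of_hasDerivAt_pos (fun t => (hφ t).hasDerivAt) hGpos
  have hinv : Function.LeftInverse (Function.invFun φ) φ :=
    Function.leftInverse_invFun hmono.injective
  refine ⟨φ, Function.invFun φ, hinv, fun t ht => ?_, fun t ht => ?_, fun t ht => ?_⟩
  · refine congrArg (a + ·) (intervalIntegral.integral_congr fun s hs => hGeq s ?_)
    rw [uIcc_of_le ht.1] at hs
    exact ⟨hs.1, hs.2.trans ht.2⟩
  · exact hGeq t ht ▸ (hφ t).hasDerivAt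
  · exact hGeq t ht ▸ ((hφ t).to_local_left_inverse (hGpos t).ne'
      (Filter.Eventually.of_forall hinv)).hasDerivAt

end Speed

/-- Fix `c > 0` and `a₃ < b₃`, and let `f : [a₃, b₃] → ℝ` be
continuously differentiable with `0 < f t < c` and `(f' t)² < 1 - (f t)²/c²` on
`[a₃, b₃]`.  Then there is a unique pair `(φ, F)` as in `IsReparam`; moreover the
unique solution is given explicitly by
`φ t = a₃ + ∫_{a₃}^{t} √((1 - f(s)²/c² - f'(s)²)/(1 - f(s)²/c²)) ds` and
`F (φ t) = c · arcsin (f t / c)`. -/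
theorem stmt_12 (c a₃ b₃ : ℝ) (hc : 0 < c) (hab : a₃ < b₃)
    (f f' : ℝ → ℝ)
    (hf : ∀ t ∈ Set.Icc a₃ b₃, HasDerivWithinAt f (f' t) (Set.Icc a₃ b₃) t)
    (hf' : ContinuousOn f' (Set.Icc a₃ b₃))
    (hcond : ∀ t ∈ Set.Icc a₃ b₃,
      0 < f t ∧ f t < c ∧ (f' t) ^ 2 < 1 - (f t) ^ 2 / c ^ 2) :
    (∃ φ φ' F F' : ℝ → ℝ, IsReparam c a₃ b₃ f φ φ' F F' ∧
      ∀ t ∈ Set.Icc a₃ b₃,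
        φ t = a₃ + (∫ s in a₃..t,
          Real.sqrt ((1 - (f s) ^ 2 / c ^ 2 - (f' s) ^ 2) / (1 - (f s) ^ 2 / c ^ 2))) ∧
        F (φ t) = c * Real.arcsin (f t / c)) ∧
    (∀ φ₁ φ₁' F₁ F₁' φ₂ φ₂' F₂ F₂' : ℝ → ℝ,
      IsReparam c a₃ b₃ f φ₁ φ₁' F₁ F₁' → IsReparam c a₃ b₃ f φ₂ φ₂' F₂ F₂' →
      Set.EqOn φ₁ φ₂ (Set.Icc a₃ b₃) ∧ Set.EqOn F₁ F₂ (φ₁ '' Set.Icc a₃ b₃)) := by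
  have hsq : ∀ t ∈ Icc a₃ b₃, f' t ^ 2 < 1 - f t ^ 2 / c ^ 2 := fun t ht => (hcond t ht).2.2
  have hspeed : ContinuousOn (reparamSpeed c f f') (Icc a₃ b₃) :=
    continuousOn_reparamSpeed (fun t ht => (hf t ht).continuousWithinAt) hf' hsq
  have hpos : ∀ t ∈ Icc a₃ b₃, 0 < reparamSpeed c f f' t :=
    fun t ht => reparamSpeed_pos (hsq t ht)
  constructor
  · obtain ⟨φ, ψ, hinv, hint, hφ, hψ⟩ := exists_primitive_leftInverse hab.le hspeed hpos
    refine ⟨φ, reparamSpeed c f f', fun y => c * Real.arcsin (f (ψ y) / c),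
      fun y => f' (ψ y) / Real.sqrt (1 - f (ψ y) ^ 2 / c ^ 2) * (reparamSpeed c f f' (ψ y))⁻¹,
      ⟨?_, fun t ht => (hφ t ht).hasDerivWithinAt, hspeed, hpos, fun t ht => ?_, fun t ht => ?_,
        fun t ht => ?_, fun t ht => ?_⟩, fun t ht => ⟨hint t ht, ?_⟩⟩
    · simp [hint a₃ (left_mem_Icc.2 hab.le)]
    · obtain ⟨h0, h1, -⟩ := hcond t ht
      have hmaps : MapsTo ψ (φ '' Icc a₃ b₃) (Icc a₃ b₃) := by
        rintro _ ⟨u, hu, rfl⟩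
        rwa [hinv u]
      have harcsin := hasDerivWithinAt_c_mul_arcsin hc h0 h1 (hf t ht)
      simp only [hinv t]
      exact harcsin.comp_of_eq (φ t) (hψ t ht).hasDerivWithinAt hmaps (hinv t).symm
    · obtain ⟨h0, h1, -⟩ := hcond t ht
      simpa only [hinv t] using c_mul_arcsin_mem_Ioo hc h0 h1
    · obtain ⟨h0, h1, -⟩ := hcond t ht
      have hdiv : 0 < f t / c := div_pos h0 hc
      simp only [hinv t]
      rw [mul_div_cancel_left₀ _ hc.ne',
        Real.sin_arcsin (by linarith) ((div_lt_one hc).2 h1).le, mul_div_cancel₀ _ hc.ne']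
    · have hne := (hpos t ht).ne'
      simp only [hinv t]
      rw [mul_pow, inv_pow, mul_add, mul_one, mul_left_comm, mul_inv_cancel₀ (pow_ne_zero 2 hne),
        mul_one, reparamSpeed_sq (hsq t ht), sub_add_cancel]
    · simp only [hinv t]
  · intro φ₁ φ₁' F₁ F₁' φ₂ φ₂' F₂ F₂' h₁ h₂
    have hφ : EqOn φ₁ φ₂ (Icc a₃ b₃) := by
      refine eq_of_derivWithin_eq (fun t ht => (h₁.2.1 t ht).differentiableWithinAt)
        (fun t ht => (h₂.2.1 t ht).differentiableWithinAt) (fun t ht => ?_) (h₁.1.trans h₂.1.symm)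
      have ht' := Ico_subset_Icc_self ht
      have huniq := uniqueDiffOn_Icc hab t ht'
      rw [(h₁.2.1 t ht').derivWithin huniq, (h₂.2.1 t ht').derivWithin huniq,
        h₁.deriv_eq hc hab hf hcond ht', h₂.deriv_eq hc hab hf hcond ht']
    refine ⟨hφ, ?_⟩
    rintro _ ⟨t, ht, rfl⟩
    rw [h₁.profile_eq hc ht, hφ ht, h₂.profile_eq hc ht]
end
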